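/- arXiv:2210.05292 — 2 statements merged into one kernel-verified Lean document; each statement's English description precedes it below -/
import Mathlib

section
/- Let φ be a Hölder continuous topologically transitive flow on a compact metric space X having at least one periodic orbit, and let ψ = φ^{r_{φ,ψ}} and ψ̂ = φ^{r_{φ,ψ̂}} be Hölder reparametrizations of φ (their periodic orbits coincide with those of φ). Assume that every ergodic ψ-invariant Borel probability measure on X is the weak-* limit of a sequence of orbital measures δ_ψ(a_j) over periodic orbits a_j (this holds whenever φ admits a strong Markov coding). Then, setting r_{ψ,ψ̂} := r_{φ,ψ̂}/r_{φ,ψ}, one has sup_{a} p_{ψ̂}(a)/p_{ψ}(a) = sup_{m ∈ P(ψ)} ∫_X r_{ψ,ψ̂} dm, where the first supremum is over all periodic orbits a; in particular both suprema are finite. -/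
open MeasureTheory Filter Topology

noncomputable section

/-- `κ_r(x,t) = ∫_0^t r(φ_s(x)) ds`, the accumulated reparametrization time. -/
def flowKappa {X : Type*} [TopologicalSpace X] (φ : Flow ℝ X) (r : X → ℝ) (x : X) (t : ℝ) : ℝ :=
  ∫ s in (0:ℝ)..t, r (φ s x)

/-- `ψ` is the reparametrization `φ^r` of the flow `φ` by the (positive continuous) function
`r`; the defining identity `ψ_t(x) = φ_{α_r(x,t)}(x)` is equivalent to
`ψ_{κ_r(x,t)}(x) = φ_t(x)` for all `x ∈ X`, `t ∈ ℝ`. -/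
def IsReparam {X : Type*} [TopologicalSpace X] (φ : Flow ℝ X) (r : X → ℝ) (ψ : Flow ℝ X) : Prop :=
  ∀ (x : X) (t : ℝ), ψ (flowKappa φ r x t) x = φ t x

/-- `x` is a periodic point of the flow `φ` with prime period `T > 0`. -/
def IsPrimePeriodicPt {X : Type*} [TopologicalSpace X] (φ : Flow ℝ X) (T : ℝ) (x : X) : Prop :=
  0 < T ∧ φ T x = x ∧ ∀ t : ℝ, 0 < t → t < T → φ t x ≠ x

/-- The orbital measure `δ_φ(a)` of the periodic orbit `a` through `x` of prime period `T`:
the pushforward of normalized Lebesgue measure on `[0,T]` under `t ↦ φ_t(x)`. -/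
def orbitalMeasure {X : Type*} [TopologicalSpace X] [MeasurableSpace X]
    (φ : Flow ℝ X) (x : X) (T : ℝ) : Measure X :=
  Measure.map (fun t : ℝ => φ t x) ((ENNReal.ofReal T)⁻¹ • volume.restrict (Set.Icc (0:ℝ) T))

/-- `P(ψ)`: the set of `ψ`-invariant Borel probability measures on `X`. -/
def flowInvProb {X : Type*} [TopologicalSpace X] [MeasurableSpace X] (ψ : Flow ℝ X) :
    Set (Measure X) :=
  {m | IsProbabilityMeasure m ∧ ∀ t : ℝ, Measure.map (ψ t) m = m}

/-- A measure `m` is ergodic for the flow `ψ` if every Borel set invariant under all the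
time-`t` maps has measure `0` or `1`. -/
def flowErgodicMeasure {X : Type*} [TopologicalSpace X] [MeasurableSpace X]
    (ψ : Flow ℝ X) (m : Measure X) : Prop :=
  ∀ s : Set X, MeasurableSet s → (∀ t : ℝ, ψ t ⁻¹' s = s) → m s = 0 ∨ m s = 1

/-- The flow `φ` is Hölder continuous: `(x,t) ↦ φ_t(x)` is Hölder on `X × [−T,T]` for
every `T > 0`. -/
def HolderFlow {X : Type*} [MetricSpace X] (φ : Flow ℝ X) : Prop :=
  ∀ T : ℝ, 0 < T → ∃ C α : NNReal, 0 < α ∧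
    HolderOnWith C α (fun p : X × ℝ => φ p.2 p.1) (Set.univ ×ˢ Set.Icc (-T) T)

/-- The flow `φ` is topologically transitive: some point has dense orbit. -/
def TopTransitive {X : Type*} [TopologicalSpace X] (φ : Flow ℝ X) : Prop :=
  ∃ x : X, Dense (Set.range fun t : ℝ => φ t x)

/-- `ψ` is a Hölder reparametrization of `φ` by the positive Hölder continuous function `r`. -/
def IsHolderReparam {X : Type*} [MetricSpace X] (φ : Flow ℝ X) (r : X → ℝ) (ψ : Flow ℝ X) :
    Prop :=
  Continuous r ∧ (∀ x, 0 < r x) ∧ (∃ C α : NNReal, 0 < α ∧ HolderWith C α r) ∧ IsReparam φ r ψ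

section InvariantMeasure

variable {X : Type*} [MetricSpace X] [MeasurableSpace X] [BorelSpace X]

theorem integral_orbitalMeasure (ψ : Flow ℝ X) (x : X) {T : ℝ} (hT : 0 < T) {g : X → ℝ}
    (hg : Continuous g) :
    ∫ y, g y ∂(orbitalMeasure ψ x T) = (∫ t in (0 : ℝ)..T, g (ψ t x)) / T := by
  have hc : Continuous fun t : ℝ => ψ t x := by fun_prop
  rw [orbitalMeasure, integral_map hc.measurable.aemeasurable hg.aestronglyMeasurable,
    integral_smul_measure, integral_Icc_eq_integral_Ioc,
    ← intervalIntegral.integral_of_le hT.le, ENNReal.toReal_inv, ENNReal.toReal_ofReal hT.le,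
    smul_eq_mul, div_eq_inv_mul]

theorem isProbabilityMeasure_orbitalMeasure (ψ : Flow ℝ X) (x : X) {T : ℝ} (hT : 0 < T) :
    IsProbabilityMeasure (orbitalMeasure ψ x T) := by
  have hc : Continuous fun t : ℝ => ψ t x := by fun_prop
  refine ⟨?_⟩
  rw [orbitalMeasure, Measure.map_apply hc.measurable MeasurableSet.univ]
  simp only [Set.preimage_univ, Measure.smul_apply, Measure.restrict_apply_univ, Real.volume_Icc,
    sub_zero, smul_eq_mul]
  exact ENNReal.inv_mul_cancel (by simpa using hT) ENNReal.ofReal_ne_top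

theorem map_flow_eq_of_integral_comp_eq (ψ : Flow ℝ X) {m : Measure X} [IsFiniteMeasure m]
    (h : ∀ (t : ℝ) (g : C(X, ℝ)), ∫ x, g (ψ t x) ∂m = ∫ x, g x ∂m) (t : ℝ) :
    Measure.map (ψ t) m = m := by
  refine ext_of_forall_integral_eq_of_IsFiniteMeasure fun f => ?_
  rw [integral_map (ψ.continuous_toFun t).measurable.aemeasurable
    f.continuous.aestronglyMeasurable]
  exact h t f.toContinuousMap

theorem cond_mem_flowInvProb {ψ : Flow ℝ X} {m : Measure X} (hm : m ∈ flowInvProb ψ) {s : Set X}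
    (hs : MeasurableSet s) (hinv : ∀ t, ψ t ⁻¹' s = s) (h0 : m s ≠ 0) :
    ProbabilityTheory.cond m s ∈ flowInvProb ψ := by
  have := hm.1
  refine ⟨ProbabilityTheory.cond_isProbabilityMeasure h0, fun t => ?_⟩
  have hmeas := (ψ.continuous_toFun t).measurable
  rw [ProbabilityTheory.cond, Measure.map_smul]
  conv_lhs => rw [← hinv t, ← Measure.restrict_map hmeas hs, hm.2 t, hinv t]

theorem orbitalMeasure_mem_flowInvProb (ψ : Flow ℝ X) {x : X} {T : ℝ}
    (h : IsPrimePeriodicPt ψ T x) : orbitalMeasure ψ x T ∈ flowInvProb ψ := by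
  obtain ⟨hT, hx, -⟩ := h
  have := isProbabilityMeasure_orbitalMeasure ψ x hT
  refine ⟨this, map_flow_eq_of_integral_comp_eq ψ fun t g => ?_⟩
  have hgt : Continuous fun y => g (ψ t y) := by fun_prop
  rw [integral_orbitalMeasure ψ x hT hgt,
    integral_orbitalMeasure ψ x hT g.continuous]
  have hp : Function.Periodic (fun s => g (ψ s x)) T := fun s => by
    simp only [ψ.map_add, hx]
  simp only [← ψ.map_add]
  rw [intervalIntegral.integral_comp_add_left (fun s => g (ψ s x)) t, add_zero,
    hp.intervalIntegral_add_eq t 0, zero_add]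

end InvariantMeasure

section Reparametrization

variable {X : Type*} [MetricSpace X]

theorem hasDerivAt_flowKappa (φ : Flow ℝ X) {r : X → ℝ} (hr : Continuous r) (x : X) (t : ℝ) :
    HasDerivAt (flowKappa φ r x) (r (φ t x)) t := by
  have hc : Continuous fun s : ℝ => r (φ s x) := by fun_prop
  exact intervalIntegral.integral_hasDerivAt_right (hc.intervalIntegrable _ _)
    (hc.stronglyMeasurableAtFilter _ _) hc.continuousAt

theorem continuous_flowKappa (φ : Flow ℝ X) {r : X → ℝ} (hr : Continuous r) (x : X) :
    Continuous (flowKappa φ r x) :=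
  continuous_iff_continuousAt.2 fun t => (hasDerivAt_flowKappa φ hr x t).continuousAt

theorem flowKappa_zero (φ : Flow ℝ X) (r : X → ℝ) (x : X) : flowKappa φ r x 0 = 0 :=
  intervalIntegral.integral_same

theorem strictMono_flowKappa (φ : Flow ℝ X) {r : X → ℝ} (hr : Continuous r)
    (hpos : ∀ x, 0 < r x) (x : X) : StrictMono (flowKappa φ r x) :=
  strictMono_of_hasDerivAt_pos (hasDerivAt_flowKappa φ hr x) fun _ => hpos _

theorem IsPrimePeriodicPt.unique {ψ : Flow ℝ X} {x : X} {T T' : ℝ}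
    (h : IsPrimePeriodicPt ψ T x) (h' : IsPrimePeriodicPt ψ T' x) : T = T' := by
  rcases lt_trichotomy T T' with hlt | heq | hlt
  · exact absurd h.2.1 (h'.2.2 T h.1 hlt)
  · exact heq
  · exact absurd h'.2.1 (h.2.2 T' h'.1 hlt)

theorem intervalIntegral_reparam {φ ψ : Flow ℝ X} {r : X → ℝ} (hr : Continuous r)
    (hψ : IsReparam φ r ψ) {g : X → ℝ} (hg : Continuous g) (x : X) (S : ℝ) :
    ∫ t in (0 : ℝ)..flowKappa φ r x S, g (ψ t x) = flowKappa φ (fun y => g y * r y) x S := by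
  have hc : Continuous fun s : ℝ => r (φ s x) := by fun_prop
  have h := intervalIntegral.integral_comp_mul_deriv (a := 0) (b := S)
    (fun s _ => hasDerivAt_flowKappa φ hr x s) hc.continuousOn
    (show Continuous fun t : ℝ => g (ψ t x) by fun_prop)
  rw [flowKappa_zero] at h
  rw [← h, flowKappa]
  simp only [Function.comp_apply, hψ x]

variable [CompactSpace X]

theorem exists_pos_flowKappa_eq (φ : Flow ℝ X) {r : X → ℝ} (hr : Continuous r)
    (hpos : ∀ x, 0 < r x) (x : X) {T : ℝ} (hT : 0 < T) :
    ∃ S, 0 < S ∧ flowKappa φ r x S = T := by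
  have : Nonempty X := ⟨x⟩
  obtain ⟨z, hz⟩ := hr.exists_forall_le_of_hasCompactSupport
    (HasCompactSupport.of_compactSpace r)
  have hle : T ≤ flowKappa φ r x (T / r z) := by
    have hc : Continuous fun s : ℝ => r (φ s x) := by fun_prop
    have h := intervalIntegral.integral_mono_on (μ := volume) (div_pos hT (hpos z)).le
      (continuous_const.intervalIntegrable 0 (T / r z)) (hc.intervalIntegrable 0 (T / r z))
      (fun s _ => hz (φ s x))
    rw [intervalIntegral.integral_const, sub_zero, smul_eq_mul,
      div_mul_cancel₀ _ (hpos z).ne'] at h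
    exact h
  obtain ⟨S, hS, hST⟩ := intermediate_value_Icc (div_pos hT (hpos z)).le
    (continuous_flowKappa φ hr x).continuousOn
    (show T ∈ Set.Icc _ _ from ⟨(flowKappa_zero φ r x).trans_le hT.le, hle⟩)
  refine ⟨S, hS.1.lt_of_ne ?_, hST⟩
  rintro rfl
  exact hT.ne ((flowKappa_zero φ r x).symm.trans hST)

theorem isPrimePeriodicPt_reparam_iff {φ ψ : Flow ℝ X} {r : X → ℝ} (hr : Continuous r)
    (hpos : ∀ x, 0 < r x) (hψ : IsReparam φ r ψ) {x : X} {S : ℝ} :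
    IsPrimePeriodicPt ψ (flowKappa φ r x S) x ↔ IsPrimePeriodicPt φ S x := by
  have hmono := strictMono_flowKappa φ hr hpos x
  have h0 : ∀ s, 0 < flowKappa φ r x s ↔ 0 < s := fun s => by
    simpa only [flowKappa_zero] using hmono.lt_iff_lt (a := 0) (b := s)
  refine and_congr (h0 S) (and_congr (by rw [hψ]) ⟨fun h s hs hsS => ?_, fun h t ht htS => ?_⟩)
  · rw [← hψ]
    exact h _ ((h0 s).2 hs) (hmono hsS)
  · obtain ⟨s, hs, rfl⟩ := exists_pos_flowKappa_eq φ hr hpos x ht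
    rw [hψ]
    exact h s hs (hmono.lt_iff_lt.1 htS)

variable [MeasurableSpace X] [BorelSpace X]

theorem exists_isPrimePeriodicPt_integral_orbitalMeasure {φ ψ ψhat : Flow ℝ X} {r rhat : X → ℝ}
    (hψ : IsHolderReparam φ r ψ) (hψhat : IsHolderReparam φ rhat ψhat) {x : X} {T : ℝ}
    (h : IsPrimePeriodicPt ψ T x) :
    ∃ T', IsPrimePeriodicPt ψhat T' x ∧
      ∫ y, rhat y / r y ∂(orbitalMeasure ψ x T) = T' / T := by
  obtain ⟨hr, hpos, -, hrep⟩ := hψ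
  obtain ⟨hr', hpos', -, hrep'⟩ := hψhat
  have hg : Continuous fun y => rhat y / r y := hr'.div hr fun y => (hpos y).ne'
  obtain ⟨S, -, rfl⟩ := exists_pos_flowKappa_eq φ hr hpos x h.1
  refine ⟨flowKappa φ rhat x S, (isPrimePeriodicPt_reparam_iff hr' hpos' hrep').2
    ((isPrimePeriodicPt_reparam_iff hr hpos hrep).1 h), ?_⟩
  rw [integral_orbitalMeasure ψ x h.1 hg, intervalIntegral_reparam hr hrep hg]
  simp only [div_mul_cancel₀ _ (hpos _).ne']

end Reparametrization

section ErgodicMaximization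

variable {X : Type*} [MetricSpace X] [CompactSpace X]

/-- The positive normalized `ψ`-invariant functionals on `C(X, ℝ)`. -/
def flowInvStates (ψ : Flow ℝ X) : Set (WeakDual ℝ C(X, ℝ)) :=
  {L | (∀ f : C(X, ℝ), 0 ≤ f → 0 ≤ L f) ∧ L 1 = 1 ∧
    ∀ (t : ℝ) (f : C(X, ℝ)), L (f.comp ⟨ψ t, ψ.continuous_toFun t⟩) = L f}

theorem isCompact_flowInvStates (ψ : Flow ℝ X) : IsCompact (flowInvStates ψ) := by
  refine (WeakDual.isCompact_closedBall (𝕜 := ℝ) (E := C(X, ℝ)) 0 1).of_isClosed_subset ?_ ?_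
  · have hev : ∀ f : C(X, ℝ), Continuous fun L : WeakDual ℝ C(X, ℝ) => L f :=
      WeakDual.eval_continuous
    simp only [flowInvStates, Set.ofPred_and, Set.ofPred_forall]
    exact (isClosed_iInter fun f => isClosed_iInter fun _ =>
        isClosed_le continuous_const (hev f)).inter
      ((isClosed_eq (hev 1) continuous_const).inter (isClosed_iInter fun t =>
        isClosed_iInter fun f => isClosed_eq (hev _) (hev f)))
  · rintro L ⟨hpos, hone, -⟩
    rw [Set.mem_preimage, mem_closedBall_zero_iff]
    refine ContinuousLinearMap.opNorm_le_bound _ zero_le_one fun f => ?_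
    have hL : ∀ g : C(X, ℝ), ‖g‖ ≤ ‖f‖ → L g ≤ ‖f‖ := fun g hg => by
      have h := hpos (‖f‖ • (1 : C(X, ℝ)) - g) fun x => by
        simpa using (le_abs_self _).trans ((g.norm_coe_le_norm x).trans hg)
      rw [map_sub, map_smul, hone, smul_eq_mul, mul_one] at h
      linarith
    rw [one_mul]
    refine abs_le'.2 ⟨hL f le_rfl, ?_⟩
    have := hL (-f) (norm_neg f).le
    rwa [map_neg] at this

variable [MeasurableSpace X] [BorelSpace X]

theorem ContinuousMap.integrable_of_isFiniteMeasure (m : Measure X) [IsFiniteMeasure m]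
    (f : C(X, ℝ)) : Integrable f m :=
  f.continuous.integrable_of_hasCompactSupport (HasCompactSupport.of_compactSpace f)

/-- Integration against a finite measure, as an element of the weak dual of `C(X, ℝ)`. -/
def integralWeakDual (m : Measure X) [IsFiniteMeasure m] : WeakDual ℝ C(X, ℝ) :=
  StrongDual.toWeakDual <| LinearMap.mkContinuous
    { toFun := fun f : C(X, ℝ) => ∫ x, f x ∂m
      map_add' := fun f g => integral_add (f.integrable_of_isFiniteMeasure m)
        (g.integrable_of_isFiniteMeasure m)
      map_smul' := fun c f => integral_const_mul c f }
    (m.real Set.univ) fun f => by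
      rw [mul_comm]
      exact norm_integral_le_of_norm_le_const (ae_of_all _ f.norm_coe_le_norm)

theorem integralWeakDual_apply (m : Measure X) [IsFiniteMeasure m] (f : C(X, ℝ)) :
    integralWeakDual m f = ∫ x, f x ∂m := rfl

theorem integralWeakDual_mem_flowInvStates {ψ : Flow ℝ X} {m : Measure X} [IsFiniteMeasure m]
    (hm : m ∈ flowInvProb ψ) : integralWeakDual m ∈ flowInvStates ψ := by
  obtain ⟨hprob, hinv⟩ := hm
  refine ⟨fun f hf => integral_nonneg hf, by simp [integralWeakDual_apply], fun t f => ?_⟩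
  rw [integralWeakDual_apply, integralWeakDual_apply]
  conv_rhs => rw [← hinv t, integral_map (ψ.continuous_toFun t).measurable.aemeasurable
    f.continuous.aestronglyMeasurable]
  rfl

theorem exists_finiteMeasure_integral_eq (L : C(X, ℝ) →ₗ[ℝ] ℝ)
    (hL : ∀ f : C(X, ℝ), 0 ≤ f → 0 ≤ L f) :
    ∃ m : Measure X, IsFiniteMeasure m ∧ ∀ f : C(X, ℝ), ∫ x, f x ∂m = L f := by
  let Λ : CompactlySupportedContinuousMap X ℝ →ₚ[ℝ] ℝ := PositiveLinearMap.mk₀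
    { toFun := fun f => L f.toContinuousMap
      map_add' := fun f g => L.map_add f.toContinuousMap g.toContinuousMap
      map_smul' := fun c f => L.map_smul c f.toContinuousMap }
    fun f hf => hL _ hf
  refine ⟨RealRMK.rieszMeasure Λ, inferInstance, fun f => ?_⟩
  exact RealRMK.integral_rieszMeasure Λ (CompactlySupportedContinuousMap.continuousMapEquiv f)

theorem exists_mem_flowInvProb_integral_eq {ψ : Flow ℝ X} {L : WeakDual ℝ C(X, ℝ)}
    (hL : L ∈ flowInvStates ψ) :
    ∃ m ∈ flowInvProb ψ, ∀ f : C(X, ℝ), ∫ x, f x ∂m = L f := by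
  obtain ⟨hpos, hone, hinv⟩ := hL
  obtain ⟨m, hm, hmL⟩ := exists_finiteMeasure_integral_eq
    (WeakDual.toStrongDual L).toLinearMap hpos
  refine ⟨m, ⟨⟨?_⟩, map_flow_eq_of_integral_comp_eq ψ fun t g => ?_⟩, hmL⟩
  · have h : ∫ x, (1 : C(X, ℝ)) x ∂m = 1 := (hmL 1).trans hone
    simp only [ContinuousMap.one_apply, integral_const, smul_eq_mul, mul_one] at h
    rw [← ENNReal.ofReal_toReal (measure_ne_top m Set.univ), ← measureReal_def, h,
      ENNReal.ofReal_one]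
  · exact (hmL (g.comp ⟨ψ t, ψ.continuous_toFun t⟩)).trans ((hinv t g).trans (hmL g).symm)

theorem flowErgodicMeasure_of_mem_extremePoints {ψ : Flow ℝ X} {m : Measure X}
    [IsFiniteMeasure m] (hm : m ∈ flowInvProb ψ)
    (hext : integralWeakDual m ∈ (flowInvStates ψ).extremePoints ℝ) :
    flowErgodicMeasure ψ m := by
  intro s hs hinv
  by_contra! hcon
  obtain ⟨h0, h1⟩ := hcon
  have := hm.1
  have hc0 : m sᶜ ≠ 0 := by rwa [Ne, prob_compl_eq_zero_iff hs]
  have hcinv : ∀ t, ψ t ⁻¹' sᶜ = sᶜ := fun t => by rw [Set.preimage_compl, hinv]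
  have hmem := cond_mem_flowInvProb hm hs hinv h0
  have hcmem := cond_mem_flowInvProb hm hs.compl hcinv hc0
  have := hmem.1
  have := hcmem.1
  have hs0 : 0 < m.real s := ENNReal.toReal_pos h0 (measure_ne_top _ _)
  have hsc0 : 0 < m.real sᶜ := ENNReal.toReal_pos hc0 (measure_ne_top _ _)
  have hsum : m.real s + m.real sᶜ = 1 := by
    rw [measureReal_add_measureReal_compl hs, probReal_univ]
  have hseg : integralWeakDual m ∈ openSegment ℝ (integralWeakDual (ProbabilityTheory.cond m s))
      (integralWeakDual (ProbabilityTheory.cond m sᶜ)) := by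
    refine ⟨m.real s, m.real sᶜ, hs0, hsc0, hsum, ?_⟩
    refine DFunLike.ext _ _ fun f => ?_
    change m.real s * ∫ x, f x ∂_ + m.real sᶜ * ∫ x, f x ∂_ = ∫ x, f x ∂m
    rw [ProbabilityTheory.cond, ProbabilityTheory.cond, integral_smul_measure,
      integral_smul_measure, ENNReal.toReal_inv, ENNReal.toReal_inv, smul_eq_mul, smul_eq_mul,
      ← measureReal_def, ← measureReal_def,
      mul_inv_cancel_left₀ hs0.ne',
      mul_inv_cancel_left₀ hsc0.ne',
      integral_add_compl hs (f.integrable_of_isFiniteMeasure m)]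
  have heq := hext.2 (integralWeakDual_mem_flowInvStates hmem)
    (integralWeakDual_mem_flowInvStates hcmem) hseg
  have hcond : ProbabilityTheory.cond m s = m :=
    ext_of_forall_integral_eq_of_IsFiniteMeasure fun f =>
      DFunLike.congr_fun heq f.toContinuousMap
  apply hc0
  rw [← hcond, ProbabilityTheory.cond_apply hs]
  simp

theorem exists_flowErgodicMeasure_forall_integral_le {ψ : Flow ℝ X}
    (hne : (flowInvProb ψ).Nonempty) (g : C(X, ℝ)) :
    ∃ m ∈ flowInvProb ψ, flowErgodicMeasure ψ m ∧
      ∀ m' ∈ flowInvProb ψ, ∫ x, g x ∂m' ≤ ∫ x, g x ∂m := by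
  obtain ⟨m₀, hm₀⟩ := hne
  have := hm₀.1
  have : LocallyConvexSpace ℝ (WeakDual ℝ C(X, ℝ)) :=
    inferInstanceAs (LocallyConvexSpace ℝ (WeakBilin (topDualPairing ℝ C(X, ℝ))))
  have hcomp := isCompact_flowInvStates ψ
  let l : WeakDual ℝ C(X, ℝ) →L[ℝ] ℝ :=
    { toFun := fun L => L g
      map_add' := fun _ _ => rfl
      map_smul' := fun _ _ => rfl
      cont := WeakDual.eval_continuous g }
  have hexp : IsExposed ℝ (flowInvStates ψ)
      {L ∈ flowInvStates ψ | ∀ L' ∈ flowInvStates ψ, l L' ≤ l L} := fun _ => ⟨l, rfl⟩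
  obtain ⟨L₀, hL₀, hmax⟩ := hcomp.exists_isMaxOn
    ⟨_, integralWeakDual_mem_flowInvStates hm₀⟩ l.continuous.continuousOn
  obtain ⟨L, hL⟩ := (hexp.isCompact hcomp).extremePoints_nonempty ⟨L₀, hL₀, hmax⟩
  obtain ⟨m, hm, hmL⟩ := exists_mem_flowInvProb_integral_eq hL.1.1
  have := hm.1
  have hLm : integralWeakDual m = L := DFunLike.ext _ _ hmL
  refine ⟨m, hm, flowErgodicMeasure_of_mem_extremePoints hm ?_, fun m' hm' => ?_⟩
  · rw [hLm]
    exact hexp.isExtreme.extremePoints_subset_extremePoints hL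
  · have := hm'.1
    rw [hmL]
    exact hL.1.2 _ (integralWeakDual_mem_flowInvStates hm')

end ErgodicMaximization

/-- for Hölder reparametrizations `ψ = φ^{r_{φ,ψ}}`, `ψ̂ = φ^{r_{φ,ψ̂}}` of a
topologically transitive Hölder flow `φ` having a periodic orbit, if every ergodic
`ψ`-invariant probability measure is a weak-* limit of orbital measures on periodic orbits,
then `sup_a p_{ψ̂}(a)/p_ψ(a) = sup_{m ∈ P(ψ)} ∫ r_{ψ,ψ̂} dm` with
`r_{ψ,ψ̂} = r_{φ,ψ̂}/r_{φ,ψ}`; in particular both suprema are finite. -/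
theorem sup_period_ratio_eq_sup_intersection {X : Type*} [MetricSpace X] [CompactSpace X]
    [MeasurableSpace X] [BorelSpace X]
    (φ ψ ψhat : Flow ℝ X) (r rhat : X → ℝ)
    (hφH : HolderFlow φ) (hφT : TopTransitive φ)
    (hper : ∃ (x : X) (T : ℝ), IsPrimePeriodicPt φ T x)
    (hψ : IsHolderReparam φ r ψ) (hψhat : IsHolderReparam φ rhat ψhat)
    (hdense : ∀ m : Measure X, m ∈ flowInvProb ψ → flowErgodicMeasure ψ m →
      ∃ (xs : ℕ → X) (Ts : ℕ → ℝ), (∀ j, IsPrimePeriodicPt ψ (Ts j) (xs j)) ∧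
        ∀ g : C(X, ℝ), Tendsto (fun j => ∫ y, g y ∂(orbitalMeasure ψ (xs j) (Ts j))) atTop
          (𝓝 (∫ y, g y ∂m))) :
    BddAbove {q : ℝ | ∃ (x : X) (T T' : ℝ),
        IsPrimePeriodicPt ψ T x ∧ IsPrimePeriodicPt ψhat T' x ∧ q = T' / T} ∧
      BddAbove ((fun m : Measure X => ∫ x, rhat x / r x ∂m) '' flowInvProb ψ) ∧
      sSup {q : ℝ | ∃ (x : X) (T T' : ℝ),
          IsPrimePeriodicPt ψ T x ∧ IsPrimePeriodicPt ψhat T' x ∧ q = T' / T} =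
        sSup ((fun m : Measure X => ∫ x, rhat x / r x ∂m) '' flowInvProb ψ) := by
  obtain ⟨hr, hpos, -, -⟩ := id hψ
  let g : C(X, ℝ) := ⟨fun y => rhat y / r y, hψhat.1.div hr fun y => (hpos y).ne'⟩
  have hsub : {q : ℝ | ∃ (x : X) (T T' : ℝ), IsPrimePeriodicPt ψ T x ∧
      IsPrimePeriodicPt ψhat T' x ∧ q = T' / T} ⊆
      (fun m : Measure X => ∫ x, rhat x / r x ∂m) '' flowInvProb ψ := by
    rintro q ⟨x, T, T', hT, hT', rfl⟩
    obtain ⟨T'', hT'', heq⟩ := exists_isPrimePeriodicPt_integral_orbitalMeasure hψ hψhat hT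
    exact ⟨_, orbitalMeasure_mem_flowInvProb ψ hT, by rw [hT'.unique hT'', ← heq]⟩
  obtain ⟨x₀, T₀, hT₀⟩ := hper
  have hne : {q : ℝ | ∃ (x : X) (T T' : ℝ), IsPrimePeriodicPt ψ T x ∧
      IsPrimePeriodicPt ψhat T' x ∧ q = T' / T}.Nonempty :=
    ⟨_, x₀, _, _, (isPrimePeriodicPt_reparam_iff hr hpos hψ.2.2.2).2 hT₀,
      (isPrimePeriodicPt_reparam_iff hψhat.1 hψhat.2.1 hψhat.2.2.2).2 hT₀, rfl⟩
  obtain ⟨m, hm, herg, hmax⟩ :=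
    exists_flowErgodicMeasure_forall_integral_le (Set.image_nonempty.1 (hne.mono hsub)) g
  have hbdd : BddAbove ((fun m : Measure X => ∫ x, rhat x / r x ∂m) '' flowInvProb ψ) :=
    ⟨∫ x, g x ∂m, by rintro _ ⟨m', hm', rfl⟩; exact hmax m' hm'⟩
  refine ⟨hbdd.mono hsub, hbdd, le_antisymm (csSup_le_csSup hbdd hne hsub) ?_⟩
  refine csSup_le (hne.mono hsub) ?_
  rintro _ ⟨m', hm', rfl⟩
  refine (hmax m' hm').trans ?_
  obtain ⟨xs, Ts, hTs, hlim⟩ := hdense m hm herg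
  refine le_of_tendsto' (hlim g) fun j => le_csSup (hbdd.mono hsub) ?_
  obtain ⟨T', hT', heq⟩ := exists_isPrimePeriodicPt_integral_orbitalMeasure hψ hψhat (hTs j)
  exact ⟨xs j, Ts j, T', hTs j, hT', heq⟩
end
end

section
/- Let φ be a flow on a compact metric space X and let V : X → ℝ be a Hölder continuous function such that for every x ∈ X the map t ↦ V(φ_t(x)) is of class C¹. Define r(x) := 1 + (d/dt)|_{t=0} V(φ_t(x)) and assume that r is continuous and r(x) > 0 for all x ∈ X. Then the map h : X → X defined by h(x) := φ_{V(x)}(x) is a homeomorphism satisfying h ∘ φ^r_t = φ_t ∘ h for all t ∈ ℝ; in particular the reparametrized flow φ^r is conjugate to φ. -/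
open MeasureTheory

noncomputable section

/-- The derivative along an orbit at time zero determines it at every time. -/
theorem Flow.hasDerivAt_of_hasDerivAt_zero {X : Type*} [TopologicalSpace X] (φ : Flow ℝ X)
    {V w : X → ℝ} (hV : ∀ x, HasDerivAt (fun t : ℝ => V (φ t x)) (w x) 0) (x : X) (t : ℝ) :
    HasDerivAt (fun s : ℝ => V (φ s x)) (w (φ t x)) t := by
  have h : HasDerivAt (fun s : ℝ => V (φ s (φ t x))) (w (φ t x)) (t - t) := by
    simpa using hV (φ t x)
  simpa [← φ.map_add] using h.comp_sub_const t t

theorem flowKappa_eq_of_hasDerivAt {X : Type*} [TopologicalSpace X] (φ : Flow ℝ X) {V r : X → ℝ}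
    (hr : ∀ x, HasDerivAt (fun t : ℝ => V (φ t x)) (r x - 1) 0) (hr_cont : Continuous r)
    (x : X) (t : ℝ) : flowKappa φ r x t = t + V (φ t x) - V x := by
  have hd (s : ℝ) : HasDerivAt (fun u : ℝ => u + V (φ u x)) (r (φ s x)) s := by
    simpa using (hasDerivAt_id' s).fun_add
      (φ.hasDerivAt_of_hasDerivAt_zero (w := fun y => r y - 1) hr x s)
  have hc : Continuous fun s : ℝ => r (φ s x) :=
    hr_cont.comp (φ.continuous continuous_id continuous_const)
  rw [flowKappa, intervalIntegral.integral_eq_sub_of_hasDerivAt (fun s _ => hd s)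
    (hc.intervalIntegrable 0 t)]
  simp

theorem flowKappa_strictMono {X : Type*} [TopologicalSpace X] (φ : Flow ℝ X) {r : X → ℝ}
    (hr_cont : Continuous r) (hr_pos : ∀ x, 0 < r x) (x : X) : StrictMono (flowKappa φ r x) := by
  have hc : Continuous fun s : ℝ => r (φ s x) :=
    hr_cont.comp (φ.continuous continuous_id continuous_const)
  refine strictMono_of_hasDerivAt_pos (f' := fun t => r (φ t x)) (fun t => ?_) fun t => hr_pos _
  exact intervalIntegral.integral_hasDerivAt_right (hc.intervalIntegrable 0 t)
    (hc.stronglyMeasurableAtFilter _ _) hc.continuousAt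

theorem surjective_add_of_continuous_of_bounded {f : ℝ → ℝ} (hf : Continuous f) {C : ℝ}
    (hC : ∀ t, |f t| ≤ C) : Function.Surjective fun t => t + f t := by
  refine (continuous_id.add hf).surjective ?_ ?_
  · exact Filter.tendsto_atTop_add_right_of_le _ (-C) Filter.tendsto_id
      fun t => (abs_le.1 (hC t)).1
  · exact Filter.tendsto_atBot_add_right_of_ge _ C Filter.tendsto_id
      fun t => (abs_le.1 (hC t)).2

/-- STATEMENT 14: if `V : X → ℝ` is Hölder continuous, of class `C¹` along the flow, and
`r(x) := 1 + (d/dt)|₀ V(φ_t(x))` is continuous and positive, then `h(x) := φ_{V(x)}(x)` is a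
homeomorphism conjugating the reparametrized flow `φ^r` to `φ`:
`h ∘ φ^r_t = φ_t ∘ h` for all `t`. -/
theorem reparam_conjugate_of_coboundary {X : Type*} [MetricSpace X] [CompactSpace X]
    (φ ψ : Flow ℝ X) (V r : X → ℝ)
    (hV_holder : ∃ C α : NNReal, 0 < α ∧ HolderWith C α V)
    (hV_C1 : ∀ x : X, ContDiff ℝ 1 (fun t : ℝ => V (φ t x)))
    (hr_def : ∀ x : X, HasDerivAt (fun t : ℝ => V (φ t x)) (r x - 1) 0)
    (hr_cont : Continuous r) (hr_pos : ∀ x, 0 < r x)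
    (hψ : IsReparam φ r ψ) :
    IsHomeomorph (fun x : X => φ (V x) x) ∧
      ∀ (t : ℝ) (x : X), φ (V (ψ t x)) (ψ t x) = φ t (φ (V x) x) := by
  obtain ⟨C, α, hα, hH⟩ := hV_holder
  have hV : Continuous V := hH.continuous hα
  have hκ := flowKappa_eq_of_hasDerivAt φ hr_def hr_cont
  have hsurj (x : X) (c : ℝ) : ∃ s, s + V (φ s x) = c := by
    obtain ⟨B, hB⟩ := isCompact_univ.exists_bound_of_continuousOn hV.continuousOn
    exact surjective_add_of_continuous_of_bounded (hV_C1 x).continuous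
      (fun t => hB (φ t x) (Set.mem_univ _)) c
  refine ⟨isHomeomorph_iff_continuous_bijective.2
    ⟨φ.continuous hV continuous_id, fun x y hxy => ?_, fun y => ?_⟩, fun t x => ?_⟩
  · have hy : y = φ (V x - V y) x := by
      have h := congrArg (φ (-V y)) hxy
      simp only [← φ.map_add, neg_add_cancel, φ.map_zero_apply] at h
      rw [← neg_add_eq_sub, h]
    have h0 : flowKappa φ r x (V x - V y) = flowKappa φ r x 0 := by
      rw [hκ, hκ, ← hy, φ.map_zero_apply]
      ring
    rw [(flowKappa_strictMono φ hr_cont hr_pos x).injective h0, φ.map_zero_apply] at hy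
    exact hy.symm
  · obtain ⟨s, hs⟩ := hsurj y 0
    refine ⟨φ s y, ?_⟩
    change φ (V (φ s y)) (φ s y) = y
    rw [← φ.map_add, add_comm, hs, φ.map_zero_apply]
  · obtain ⟨s, hs⟩ := hsurj x (t + V x)
    have ht : flowKappa φ r x s = t := by
      rw [hκ, hs, add_sub_cancel_right]
    rw [← ht, hψ x s, ht, ← φ.map_add, ← φ.map_add, add_comm, hs]
end
end
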